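/- Let 1 ≤ m ≤ n−1. There exist constants c_{n,m}, d_{n,m} > 0 depending only on n and m such that for all x ∈ ℝ^n and all r ∈ (0,1), c_{n,m} φ_r^m(x) ≤ ∫_{G(n,m)} 1_{[0,r]}(|π_V x|) dγ_{n,m}(V) ≤ d_{n,m} φ_r^m(x). -/

import Mathlib

open MeasureTheory Metric Set Filter Topology
open scoped ENNReal NNReal

noncomputable section

/-- Euclidean space `ℝ^n`. -/
abbrev Euc (n : ℕ) := EuclideanSpace ℝ (Fin n)

instance matrixMeasurableSpace (n : ℕ) : MeasurableSpace (Matrix (Fin n) (Fin n) ℝ) :=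
  inferInstanceAs (MeasurableSpace (Fin n → Fin n → ℝ))

/-- The restricted covering sum `S_{r,θ}^s(E)`: the infimum of `Σ_i |U_i|^s` over all
countable covers `{U_i}` of `E` with `r ≤ |U_i| ≤ r^θ`, valued in `ℝ≥0∞`. -/
def coverSum (n : ℕ) (E : Set (Euc n)) (θ s r : ℝ) : ℝ≥0∞ :=
  sInf { T : ℝ≥0∞ | ∃ 𝒰 : Set (Set (Euc n)), 𝒰.Countable ∧ E ⊆ ⋃₀ 𝒰 ∧
    (∀ U ∈ 𝒰, r ≤ diam U ∧ diam U ≤ r ^ θ) ∧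
    T = ∑' U : 𝒰, ENNReal.ofReal (diam (U : Set (Euc n)) ^ s) }

/-- Real-valued version of `coverSum`. -/
def Sval (n : ℕ) (E : Set (Euc n)) (θ s r : ℝ) : ℝ := (coverSum n E θ s r).toReal

/-- The quotient `log S_{r,θ}^s(E) / (-log r)`. -/
def Squot (n : ℕ) (E : Set (Euc n)) (θ s r : ℝ) : ℝ :=
  Real.log (Sval n E θ s r) / (-Real.log r)

/-- `N_δ(E)`: the smallest number of sets of diameter at most `δ` needed to cover `E`. -/
def covNum (n : ℕ) (E : Set (Euc n)) (δ : ℝ) : ℕ :=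
  sInf { k : ℕ | ∃ U : Fin k → Set (Euc n), E ⊆ ⋃ i, U i ∧ ∀ i, diam (U i) ≤ δ }

/-- The lower box-counting dimension of `E`. -/
def lowerBoxDim (n : ℕ) (E : Set (Euc n)) : ℝ :=
  liminf (fun δ : ℝ => Real.log (covNum n E δ) / (-Real.log δ)) (𝓝[>] 0)

/-- The upper box-counting dimension of `E`. -/
def upperBoxDim (n : ℕ) (E : Set (Euc n)) : ℝ :=
  limsup (fun δ : ℝ => Real.log (covNum n E δ) / (-Real.log δ)) (𝓝[>] 0)

/-- The kernel `φ_{r,θ}^{s,m}`. -/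
def phiK (n : ℕ) (m s θ r : ℝ) (x : Euc n) : ℝ :=
  if ‖x‖ < r then 1
  else if ‖x‖ < r ^ θ then (r / ‖x‖) ^ s
  else r ^ (θ * (m - s) + s) / ‖x‖ ^ m

/-- The kernel `φ̃_{r,θ}^s`. -/
def phiT (n : ℕ) (s θ r : ℝ) (x : Euc n) : ℝ :=
  if ‖x‖ < r then 1
  else if ‖x‖ ≤ r ^ θ then (r / ‖x‖) ^ s
  else 0

/-- The kernel `φ_r^m(x) = min{1, (r/|x|)^m}`. -/
def phiB (n : ℕ) (m r : ℝ) (x : Euc n) : ℝ :=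
  if ‖x‖ ≤ r then 1 else (r / ‖x‖) ^ m

/-- The energy `∬ φ(x-y) dμ(x)dμ(y)` of a measure with respect to a kernel `φ`. -/
def energy (n : ℕ) (φ : Euc n → ℝ) (μ : Measure (Euc n)) : ℝ :=
  ∫ x, ∫ y, φ (x - y) ∂μ ∂μ

/-- The potential `∫ φ(x-y) dμ(y)` of a measure at `x` with respect to a kernel `φ`. -/
def potential (n : ℕ) (φ : Euc n → ℝ) (μ : Measure (Euc n)) (x : Euc n) : ℝ :=
  ∫ y, φ (x - y) ∂μ

/-- `μ` is a Borel probability measure supported on `E`. -/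
def PMeasOn (n : ℕ) (E : Set (Euc n)) (μ : Measure (Euc n)) : Prop :=
  IsProbabilityMeasure μ ∧ μ Eᶜ = 0

/-- The capacity `C_{r,θ}^{s,m}(E)`: the reciprocal of the infimal energy of Borel
probability measures supported on `E` with respect to the kernel `φ_{r,θ}^{s,m}`. -/
def capacity (n : ℕ) (m s θ r : ℝ) (E : Set (Euc n)) : ℝ :=
  (sInf { e : ℝ | ∃ μ : Measure (Euc n), PMeasOn n E μ ∧ e = energy n (phiK n m s θ r) μ })⁻¹

/-- The quotient `log C_{r,θ}^{s,m}(E) / (-log r)`. -/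
def Cquot (n : ℕ) (m s θ : ℝ) (E : Set (Euc n)) (r : ℝ) : ℝ :=
  Real.log (capacity n m s θ r E) / (-Real.log r)

/-- `d` is the lower intermediate dimension `\underline{dim}_θ E`, i.e. the unique
`s ∈ [0,n]` such that `liminf_{r→0} log S_{r,θ}^s(E) / (-log r) = 0`. -/
def IsLowerInterDim (n : ℕ) (θ : ℝ) (E : Set (Euc n)) (d : ℝ) : Prop :=
  d ∈ Icc (0:ℝ) n ∧ liminf (fun r => Squot n E θ d r) (𝓝[>] 0) = 0

/-- `d` is the upper intermediate dimension `\overline{dim}_θ E`. -/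
def IsUpperInterDim (n : ℕ) (θ : ℝ) (E : Set (Euc n)) (d : ℝ) : Prop :=
  d ∈ Icc (0:ℝ) n ∧ limsup (fun r => Squot n E θ d r) (𝓝[>] 0) = 0

/-- `d` is the lower intermediate dimension profile `\underline{dim}_θ^m E`, i.e. the unique
`s ∈ [0,m]` such that `liminf_{r→0} log C_{r,θ}^{s,m}(E) / (-log r) = s`; for bounded sets the
capacity is that of the closure. -/
def IsLowerDimProfile (n m : ℕ) (θ : ℝ) (E : Set (Euc n)) (d : ℝ) : Prop :=
  d ∈ Icc (0:ℝ) m ∧ liminf (fun r => Cquot n m d θ (closure E) r) (𝓝[>] 0) = d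

/-- `d` is the upper intermediate dimension profile `\overline{dim}_θ^m E`. -/
def IsUpperDimProfile (n m : ℕ) (θ : ℝ) (E : Set (Euc n)) (d : ℝ) : Prop :=
  d ∈ Icc (0:ℝ) m ∧ limsup (fun r => Cquot n m d θ (closure E) r) (𝓝[>] 0) = d

/-- `P` is the matrix of an orthogonal projection of `ℝ^n` onto an `m`-dimensional subspace;
such matrices parametrise the Grassmannian `G(n,m)`. -/
def IsProjMat (n m : ℕ) (P : Matrix (Fin n) (Fin n) ℝ) : Prop :=
  P.transpose = P ∧ P * P = P ∧ P.rank = m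

/-- The orthogonal projection map `π_V` associated to a projection matrix. -/
def projMap (n : ℕ) (P : Matrix (Fin n) (Fin n) ℝ) : Euc n → Euc n :=
  fun x => Matrix.toEuclideanLin P x

/-- `γ` is the natural invariant measure `γ_{n,m}` on the Grassmannian `G(n,m)` (realised as
the space of orthogonal projection matrices of rank `m`): a probability measure supported on
the rank-`m` orthogonal projections and invariant under the action of the orthogonal group. -/
def IsGrassMeasure (n m : ℕ) (γ : Measure (Matrix (Fin n) (Fin n) ℝ)) : Prop :=
  IsProbabilityMeasure γ ∧ γ {P | IsProjMat n m P}ᶜ = 0 ∧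
  ∀ A ∈ Matrix.orthogonalGroup (Fin n) ℝ,
    Measure.map (fun P => A * P * A.transpose) γ = γ

theorem euc_norm_sq_eq_sum (n : ℕ) (b : OrthonormalBasis (Fin n) ℝ (Euc n)) (x : Euc n) :
    ‖x‖ ^ 2 = ∑ i, (b.repr x i) ^ 2 := by
  rw [← b.repr.norm_map x, EuclideanSpace.real_norm_sq_eq]

/-- A rank-`m` projection matrix acts, in a suitable orthonormal basis, by deleting all but `m`
coordinates. -/
theorem IsProjMat.exists_basis {n m : ℕ} {P : Matrix (Fin n) (Fin n) ℝ} (hP : IsProjMat n m P) :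
    ∃ (b : OrthonormalBasis (Fin n) ℝ (Euc n)) (S : Finset (Fin n)), S.card = m ∧
      ∀ x, ‖projMap n P x‖ ^ 2 = ∑ i ∈ S, (b.repr x i) ^ 2 := by
  obtain ⟨hT, hPP, hr⟩ := hP
  have hH : P.IsHermitian := by
    rw [Matrix.IsHermitian, Matrix.conjTranspose_eq_transpose_of_trivial, hT]
  have hsym := Matrix.isSymmetric_toEuclideanLin_iff.mpr hH
  have happ : ∀ i, Matrix.toEuclideanLin P (hH.eigenvectorBasis i) =
      hH.eigenvalues i • hH.eigenvectorBasis i := by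
    intro i
    apply WithLp.ofLp_injective 2
    simpa using hH.mulVec_eigenvectorBasis i
  have hev : ∀ i, hH.eigenvalues i = 0 ∨ hH.eigenvalues i = 1 := by
    intro i
    have h2 : Matrix.toEuclideanLin P (Matrix.toEuclideanLin P (hH.eigenvectorBasis i)) =
        Matrix.toEuclideanLin P (hH.eigenvectorBasis i) := by
      rw [← LinearMap.comp_apply, ← Matrix.toLpLin_mul_same, hPP]
    rw [happ, map_smul, happ, smul_smul] at h2
    have h3 := smul_left_injective ℝ (hH.eigenvectorBasis.orthonormal.ne_zero i) h2
    have h4 : hH.eigenvalues i * (hH.eigenvalues i - 1) = 0 := by linarith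
    rcases mul_eq_zero.mp h4 with h | h
    · exact Or.inl h
    · exact Or.inr (by linarith)
  refine ⟨hH.eigenvectorBasis, Finset.univ.filter (fun i => hH.eigenvalues i ≠ 0), ?_, ?_⟩
  · rw [← hr, hH.rank_eq_card_non_zero_eigs, Fintype.card_subtype]
  · intro x
    rw [euc_norm_sq_eq_sum n hH.eigenvectorBasis, Finset.sum_filter]
    refine Finset.sum_congr rfl fun i _ => ?_
    have : hH.eigenvectorBasis.repr (projMap n P x) i =
        hH.eigenvalues i * hH.eigenvectorBasis.repr x i := by
      rw [OrthonormalBasis.repr_apply_apply, OrthonormalBasis.repr_apply_apply, projMap,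
        ← hsym, happ, real_inner_smul_left]
    rw [this]
    rcases hev i with h | h <;> simp [h]

theorem IsProjMat.norm_projMap_le {n m : ℕ} {P : Matrix (Fin n) (Fin n) ℝ}
    (hP : IsProjMat n m P) (x : Euc n) : ‖projMap n P x‖ ≤ ‖x‖ := by
  obtain ⟨b, S, -, h⟩ := hP.exists_basis
  rw [← sq_le_sq₀ (norm_nonneg _) (norm_nonneg _), h, euc_norm_sq_eq_sum n b x]
  exact Finset.sum_le_sum_of_subset_of_nonneg (Finset.subset_univ _) fun i _ _ => sq_nonneg _

theorem volume_preimage_repr_pi_Icc {n : ℕ} (b : OrthonormalBasis (Fin n) ℝ (Euc n))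
    (u v : Fin n → ℝ) (huv : ∀ i, u i ≤ v i) :
    volume {x : Euc n | ∀ i, b.repr x i ∈ Icc (u i) (v i)} =
      ENNReal.ofReal (∏ i, (v i - u i)) := by
  have hmp := (PiLp.volume_preserving_ofLp (Fin n)).comp b.measurePreserving_repr
  have hset : {x : Euc n | ∀ i, b.repr x i ∈ Icc (u i) (v i)} =
      (WithLp.ofLp ∘ b.repr) ⁻¹' Icc u v := by
    ext x
    simp [Pi.le_def, forall_and]
  rw [hset, hmp.measure_preimage measurableSet_Icc.nullMeasurableSet, Real.volume_Icc_pi,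
    ENNReal.ofReal_prod_of_nonneg fun i _ => sub_nonneg.mpr (huv i)]

theorem prod_ite_mem_one {n : ℕ} (S : Finset (Fin n)) (t : ℝ) :
    ∏ i, (if i ∈ S then t else 1) = t ^ S.card := by
  rw [Finset.prod_ite]; simp

theorem projCone_volume_le {n m : ℕ} {P : Matrix (Fin n) (Fin n) ℝ} (hP : IsProjMat n m P)
    {t R : ℝ} (ht : 0 ≤ t) (hR : 0 ≤ R) :
    volume {x : Euc n | ‖x‖ ≤ R ∧ ‖projMap n P x‖ ≤ t * ‖x‖} ≤
      ENNReal.ofReal ((2 * R) ^ n * t ^ m) := by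
  obtain ⟨b, S, hS, h⟩ := hP.exists_basis
  have hnn : ∀ i, 0 ≤ R * (if i ∈ S then t else 1) := fun i => by split_ifs <;> positivity
  have hvol := volume_preimage_repr_pi_Icc b (fun i => -(R * if i ∈ S then t else 1))
    (fun i => R * if i ∈ S then t else 1) (fun i => by linarith [hnn i])
  have hprod : ∏ i, ((R * if i ∈ S then t else 1) - -(R * if i ∈ S then t else 1)) =
      (2 * R) ^ n * t ^ m := by
    rw [← hS, ← prod_ite_mem_one S t]
    calc _ = ∏ i, ((2 * R) * if i ∈ S then t else 1) := Finset.prod_congr rfl fun i _ => by ring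
      _ = _ := by rw [Finset.prod_mul_distrib]; simp
  rw [← hprod, ← hvol]
  refine measure_mono fun x ⟨hx, hPx⟩ i => ?_
  refine abs_le.mp (abs_le_of_sq_le_sq ?_ (hnn i))
  by_cases hi : i ∈ S
  · simp only [hi, if_true]
    calc (b.repr x i) ^ 2 ≤ ∑ i ∈ S, (b.repr x i) ^ 2 :=
          Finset.single_le_sum (f := fun i => (b.repr x i) ^ 2) (fun i _ => sq_nonneg _) hi
      _ = ‖projMap n P x‖ ^ 2 := (h x).symm
      _ ≤ (R * t) ^ 2 := by
          refine pow_le_pow_left₀ (norm_nonneg _) (hPx.trans ?_) 2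
          rw [mul_comm]; gcongr
  · simp only [hi, if_false, mul_one]
    calc (b.repr x i) ^ 2 ≤ ∑ i, (b.repr x i) ^ 2 :=
          Finset.single_le_sum (f := fun i => (b.repr x i) ^ 2) (fun i _ => sq_nonneg _)
            (Finset.mem_univ i)
      _ = ‖x‖ ^ 2 := (euc_norm_sq_eq_sum n b x).symm
      _ ≤ R ^ 2 := pow_le_pow_left₀ (norm_nonneg _) hx 2

theorem le_projCone_volume {n m : ℕ} (hmn : m < n) {P : Matrix (Fin n) (Fin n) ℝ}
    (hP : IsProjMat n m P) {t : ℝ} (ht : 0 ≤ t) (ht1 : t ≤ 1) :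
    ENNReal.ofReal (t ^ m) ≤
      volume {x : Euc n | ‖x‖ ≤ ((n : ℝ) + 1) ^ 2 ∧ ‖projMap n P x‖ ≤ t * ‖x‖} := by
  obtain ⟨b, S, hS, h⟩ := hP.exists_basis
  have hvol := volume_preimage_repr_pi_Icc b (fun i => if i ∈ S then 0 else (n : ℝ))
    (fun i => if i ∈ S then t else (n : ℝ) + 1) (fun i => by split_ifs <;> simp [ht])
  have hprod : ∏ i, ((if i ∈ S then t else (n : ℝ) + 1) - (if i ∈ S then 0 else (n : ℝ))) =
      t ^ m := by
    rw [← hS, ← prod_ite_mem_one S t]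
    refine Finset.prod_congr rfl fun i _ => ?_
    split_ifs <;> simp
  rw [← hprod, ← hvol]
  refine measure_mono fun x hx => ?_
  have hn : (1 : ℝ) ≤ n := by exact_mod_cast (by omega : 1 ≤ n)
  have hbd : ∀ i, 0 ≤ b.repr x i ∧ b.repr x i ≤ n + 1 := by
    intro i
    have := hx i
    by_cases hi : i ∈ S <;> simp only [hi, if_true, if_false, mem_Icc] at this <;>
      constructor <;> linarith [this.1, this.2]
  refine ⟨?_, ?_⟩
  · refine le_of_sq_le_sq ?_ (by positivity)
    rw [euc_norm_sq_eq_sum n b]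
    calc ∑ i, (b.repr x i) ^ 2 ≤ ∑ _i : Fin n, ((n : ℝ) + 1) ^ 2 :=
          Finset.sum_le_sum fun i _ => pow_le_pow_left₀ (hbd i).1 (hbd i).2 2
      _ = n * ((n : ℝ) + 1) ^ 2 := by simp
      _ ≤ (((n : ℝ) + 1) ^ 2) ^ 2 := by
          rw [sq (((n : ℝ) + 1) ^ 2)]
          gcongr
          nlinarith
  · obtain ⟨j, hj⟩ : ∃ j, j ∉ S := by
      by_contra! hall
      have : S = Finset.univ := Finset.eq_univ_iff_forall.mpr hall
      rw [this, Finset.card_univ, Fintype.card_fin] at hS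
      omega
    have hxn : (n : ℝ) ≤ ‖x‖ := by
      refine le_of_sq_le_sq ?_ (norm_nonneg _)
      rw [euc_norm_sq_eq_sum n b]
      have hj' := hx j
      simp only [hj, if_false, mem_Icc] at hj'
      calc (n : ℝ) ^ 2 ≤ (b.repr x j) ^ 2 := pow_le_pow_left₀ (by positivity) hj'.1 2
        _ ≤ _ := Finset.single_le_sum (f := fun i => (b.repr x i) ^ 2)
            (fun i _ => sq_nonneg _) (Finset.mem_univ j)
    refine le_of_sq_le_sq ?_ (by positivity)
    rw [h]
    calc ∑ i ∈ S, (b.repr x i) ^ 2 ≤ ∑ _i ∈ S, t ^ 2 := by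
          refine Finset.sum_le_sum fun i hi => ?_
          have := hx i
          simp only [hi, if_true, mem_Icc] at this
          exact pow_le_pow_left₀ this.1 this.2 2
      _ = m * t ^ 2 := by simp [hS]
      _ ≤ (n : ℝ) ^ 2 * t ^ 2 := by
          have : (m : ℝ) ≤ n := by exact_mod_cast hmn.le
          gcongr
          nlinarith
      _ ≤ (t * ‖x‖) ^ 2 := by
          rw [mul_pow, mul_comm]
          gcongr

theorem measurable_matrix_entry {n : ℕ} (i j : Fin n) :
    Measurable fun P : Matrix (Fin n) (Fin n) ℝ => P i j :=
  (measurable_pi_apply j).comp (measurable_pi_apply (X := fun _ : Fin n => Fin n → ℝ) i)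

theorem measurable_projMap (n : ℕ) :
    Measurable fun p : Matrix (Fin n) (Fin n) ℝ × Euc n => projMap n p.1 p.2 := by
  refine (WithLp.measurable_toLp 2 (Fin n → ℝ)).comp (measurable_pi_lambda _ fun i => ?_)
  change Measurable fun p : Matrix (Fin n) (Fin n) ℝ × Euc n => ∑ j, p.1 i j * p.2 j
  refine Finset.measurable_fun_sum (M := ℝ) _ fun j _ => ?_
  exact ((measurable_matrix_entry i j).comp measurable_fst).mul
    (((measurable_pi_apply j).comp (WithLp.measurable_ofLp 2 _)).comp measurable_snd)

theorem exists_orthogonal_map_eq {n : ℕ} {x y : Euc n} (h : ‖x‖ = ‖y‖) :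
    ∃ A ∈ Matrix.orthogonalGroup (Fin n) ℝ, (∀ z, ‖projMap n A z‖ = ‖z‖) ∧
      projMap n A.transpose x = y := by
  set R := (ℝ ∙ (x - y))ᗮ.reflection with hR
  set A : Matrix (Fin n) (Fin n) ℝ := Matrix.toEuclideanLin.symm R.toLinearMap with hA
  have hAR : ∀ z, Matrix.toEuclideanLin A z = R z := by
    intro z
    rw [hA, LinearEquiv.apply_symm_apply]
    rfl
  have hsym : A.transpose = A := by
    have : A.IsHermitian := by
      rw [← Matrix.isSymmetric_toEuclideanLin_iff]
      intro u v
      rw [hAR, hAR, ← R.inner_map_map u (R v), hR, Submodule.reflection_reflection]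
    rwa [Matrix.IsHermitian, Matrix.conjTranspose_eq_transpose_of_trivial] at this
  have hAA : A * A = 1 := by
    apply Matrix.toEuclideanLin.injective
    ext1 z
    rw [Matrix.toLpLin_mul_same, LinearMap.comp_apply, hAR, hAR, hR,
      Submodule.reflection_reflection, Matrix.toLpLin_one]
    rfl
  refine ⟨A, ?_, fun z => ?_, ?_⟩
  · rw [Matrix.mem_orthogonalGroup_iff, hsym, hAA]
  · rw [projMap, hAR, R.norm_map]
  · rw [hsym, projMap, hAR, hR, Submodule.reflection_sub h]

/-- The set of matrices `P` with `|P x| ≤ t |x|`. -/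
def projSmall (n : ℕ) (t : ℝ) (x : Euc n) : Set (Matrix (Fin n) (Fin n) ℝ) :=
  {P | ‖projMap n P x‖ ≤ t * ‖x‖}

theorem measurableSet_projSmall (n : ℕ) (t : ℝ) (x : Euc n) :
    MeasurableSet (projSmall n t x) :=
  measurableSet_le ((measurable_projMap n).comp measurable_prodMk_right).norm measurable_const

theorem projSmall_smul {n : ℕ} (t : ℝ) {s : ℝ} (hs : 0 < s) (x : Euc n) :
    projSmall n t (s • x) = projSmall n t x := by
  ext P
  simp only [projSmall, mem_ofPred_eq, projMap, map_smul, norm_smul, Real.norm_eq_abs,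
    abs_of_pos hs]
  rw [mul_left_comm, mul_le_mul_iff_right₀ hs]

theorem IsGrassMeasure.measure_projSmall_eq {n m : ℕ} {γ : Measure (Matrix (Fin n) (Fin n) ℝ)}
    (hγ : IsGrassMeasure n m γ) (t : ℝ) {x y : Euc n} (hx : x ≠ 0) (hy : y ≠ 0) :
    γ (projSmall n t x) = γ (projSmall n t y) := by
  have hx' := norm_pos_iff.mpr hx
  have hy' := norm_pos_iff.mpr hy
  have hs : 0 < ‖x‖ / ‖y‖ := by positivity
  rw [← projSmall_smul t hs y]
  set w := (‖x‖ / ‖y‖) • y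
  have hw : ‖w‖ = ‖x‖ := by
    rw [norm_smul, Real.norm_eq_abs, abs_of_pos hs]
    field_simp
  obtain ⟨A, hA, hAn, hAw⟩ := exists_orthogonal_map_eq hw
  have hmeas : Measurable fun P : Matrix (Fin n) (Fin n) ℝ => A * P * A.transpose := by
    refine measurable_pi_lambda _ fun i => measurable_pi_lambda _ fun j => ?_
    change Measurable fun P : Matrix (Fin n) (Fin n) ℝ => ∑ k, (∑ l, A i l * P l k) * A j k
    refine Finset.measurable_fun_sum (M := ℝ) _ fun k _ => Measurable.mul_const (M := ℝ) ?_ _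
    exact Finset.measurable_fun_sum (M := ℝ) _ fun l _ =>
      (measurable_matrix_entry l k).const_mul _
  rw [← hγ.2.2 A hA, Measure.map_apply hmeas (measurableSet_projSmall n t w),
    hγ.2.2 A hA]
  congr 1
  ext P
  have : projMap n (A * P * A.transpose) w = projMap n A (projMap n P x) := by
    rw [← hAw]
    simp only [projMap, Matrix.toLpLin_mul_same, LinearMap.comp_apply]
  simp only [projSmall, mem_preimage, mem_ofPred_eq, this, hAn, hw]

/-- Averaging the invariant measure over a ball. -/
theorem IsGrassMeasure.measure_projSmall_mul_volume {n m : ℕ}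
    {γ : Measure (Matrix (Fin n) (Fin n) ℝ)} (hγ : IsGrassMeasure n m γ) (hn : 0 < n) (t R : ℝ)
    {x : Euc n} (hx : x ≠ 0) :
    γ (projSmall n t x) * volume (closedBall (0 : Euc n) R) =
      ∫⁻ P, volume {z : Euc n | ‖z‖ ≤ R ∧ ‖projMap n P z‖ ≤ t * ‖z‖} ∂γ := by
  have := hγ.1
  have : Nonempty (Fin n) := ⟨⟨0, hn⟩⟩
  set ν : Measure (Euc n) := volume.restrict (closedBall 0 R) with hν
  have hT : MeasurableSet {p : Matrix (Fin n) (Fin n) ℝ × Euc n |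
      ‖projMap n p.1 p.2‖ ≤ t * ‖p.2‖} :=
    measurableSet_le (measurable_projMap n).norm (measurable_snd.norm.const_mul t)
  have h1 := Measure.prod_apply (μ := γ) (ν := ν) hT
  rw [Measure.prod_apply_symm hT] at h1
  have hL : ∫⁻ z, γ ((fun P => (P, z)) ⁻¹' {p : Matrix (Fin n) (Fin n) ℝ × Euc n |
      ‖projMap n p.1 p.2‖ ≤ t * ‖p.2‖}) ∂ν =
      γ (projSmall n t x) * volume (closedBall (0 : Euc n) R) := by
    rw [← Measure.restrict_apply_univ (closedBall (0 : Euc n) R), ← hν, ← lintegral_const]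
    refine lintegral_congr_ae ?_
    have hne : ∀ᵐ z : Euc n ∂ν, z ≠ 0 :=
      ae_restrict_of_ae (by simp [ae_iff])
    filter_upwards [hne] with z hz
    exact hγ.measure_projSmall_eq t hz hx
  rw [← hL, h1]
  refine lintegral_congr fun P => ?_
  rw [hν, Measure.restrict_apply (measurable_prodMk_left hT)]
  congr 1
  ext z
  simp [and_comm]

/-- Two-sided comparison of `∫ 1_{[0,r]}(|π_V x|) dγ_{n,m}(V)` with the
kernel `φ_r^m(x) = min{1,(r/|x|)^m}`, with constants depending only on `n` and `m`. -/
theorem statement14 (n m : ℕ) (hm1 : 1 ≤ m) (hmn : m ≤ n - 1)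
    (γ : Measure (Matrix (Fin n) (Fin n) ℝ)) (hγ : IsGrassMeasure n m γ) :
    ∃ c : ℝ, 0 < c ∧ ∃ d : ℝ, 0 < d ∧
      ∀ x : Euc n, ∀ r : ℝ, r ∈ Ioo (0:ℝ) 1 →
        c * phiB n m r x ≤ (∫ P, (if ‖projMap n P x‖ ≤ r then (1:ℝ) else 0) ∂γ) ∧
        (∫ P, (if ‖projMap n P x‖ ≤ r then (1:ℝ) else 0) ∂γ) ≤ d * phiB n m r x := by
  have hprob := hγ.1
  have hae : ∀ᵐ P ∂γ, IsProjMat n m P := by rw [ae_iff]; exact hγ.2.1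
  have hn : 0 < n := by omega
  set R : ℝ := ((n : ℝ) + 1) ^ 2 with hR
  have hR0 : 0 < R := by positivity
  set V : ℝ := (volume (closedBall (0 : Euc n) R)).toReal with hV
  have hVtop : volume (closedBall (0 : Euc n) R) ≠ ⊤ := measure_closedBall_lt_top.ne
  have hV0 : 0 < V := ENNReal.toReal_pos (measure_closedBall_pos volume _ hR0).ne' hVtop
  refine ⟨min 1 (1 / V), by positivity, max 1 ((2 * R) ^ n / V), by positivity, fun x r hr => ?_⟩
  have hr0 := hr.1
  unfold phiB
  split_ifs with hxr
  · have : ∫ P, (if ‖projMap n P x‖ ≤ r then (1:ℝ) else 0) ∂γ = 1 := by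
      rw [integral_congr_ae (g := fun _ => (1 : ℝ))]
      · simp
      · filter_upwards [hae] with P hP
        simp [(hP.norm_projMap_le x).trans hxr]
    rw [this]
    simp
  · push Not at hxr
    have hx0 : 0 < ‖x‖ := hr0.trans hxr
    set t := r / ‖x‖ with ht
    have ht0 : 0 < t := by positivity
    have ht1 : t ≤ 1 := (div_le_one hx0).mpr hxr.le
    have hrt : r = t * ‖x‖ := by rw [ht]; field_simp
    have hint : ∫ P, (if ‖projMap n P x‖ ≤ r then (1:ℝ) else 0) ∂γ =
        (γ (projSmall n t x)).toReal := by
      have : (fun P => if ‖projMap n P x‖ ≤ r then (1:ℝ) else 0) =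
          (projSmall n t x).indicator 1 := by
        ext P
        simp [indicator, projSmall, ← hrt]
      rw [this, integral_indicator_one (measurableSet_projSmall n t x), Measure.real]
    have hkey := hγ.measure_projSmall_mul_volume hn t R (norm_pos_iff.mp hx0)
    have hup : (γ (projSmall n t x)).toReal * V ≤ (2 * R) ^ n * t ^ m := by
      rw [hV, ← ENNReal.toReal_mul, hkey]
      refine ENNReal.toReal_le_of_le_ofReal (by positivity) ?_
      calc _ ≤ ∫⁻ _, ENNReal.ofReal ((2 * R) ^ n * t ^ m) ∂γ := by
            refine lintegral_mono_ae ?_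
            filter_upwards [hae] with P hP
            exact projCone_volume_le hP ht0.le hR0.le
        _ = _ := by simp
    have hlow : t ^ m ≤ (γ (projSmall n t x)).toReal * V := by
      rw [hV, ← ENNReal.toReal_mul, ← ENNReal.ofReal_le_iff_le_toReal
        (ENNReal.mul_ne_top (measure_ne_top _ _) hVtop), hkey]
      calc ENNReal.ofReal (t ^ m) = ∫⁻ _, ENNReal.ofReal (t ^ m) ∂γ := by simp
        _ ≤ _ := by
            refine lintegral_mono_ae ?_
            filter_upwards [hae] with P hP
            exact le_projCone_volume (by omega) hP ht0.le ht1
    rw [hint, Real.rpow_natCast]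
    have htm : 0 ≤ t ^ m := by positivity
    constructor
    · calc min 1 (1 / V) * t ^ m ≤ 1 / V * t ^ m := by gcongr; exact min_le_right _ _
        _ = t ^ m / V := by ring
        _ ≤ _ := (div_le_iff₀ hV0).mpr hlow
    · calc (γ (projSmall n t x)).toReal ≤ (2 * R) ^ n * t ^ m / V := (le_div_iff₀ hV0).mpr hup
        _ = (2 * R) ^ n / V * t ^ m := by ring
        _ ≤ _ := by gcongr; exact le_max_right _ _
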